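/- Minkowski space M = ℝ⁴ equipped with the Zeeman topology Z is first countable: every point x ∈ M has a countable neighborhood basis for Z (for instance, the sets (B_E(x,1/n) \ N(x)) ∪ {x} for n ∈ ℕ, n ≥ 1). -/

import Mathlib

noncomputable section

/-- Minkowski space: `ℝ⁴` with the Euclidean (norm) topology as its
standard topology. -/
abbrev M4 : Type := EuclideanSpace ℝ (Fin 4)

/-- The Minkowski quadratic form `Q(x) = x₀² − x₁² − x₂² − x₃²`. -/
def Q (x : M4) : ℝ := x 0 ^ 2 - x 1 ^ 2 - x 2 ^ 2 - x 3 ^ 2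

/-- The light cone of a point `x`. -/
def lightCone (x : M4) : Set M4 := {y : M4 | y ≠ x ∧ Q (y - x) = 0}

/-- The basic Zeeman neighbourhood `(B_E(x,r) \ N(x)) ∪ {x}`. -/
def zeemanBall (x : M4) (r : ℝ) : Set M4 :=
  (Metric.ball x r \ lightCone x) ∪ {x}

/-- The Zeeman topology `Z`, generated by the sets `(B_E(x,r) \ N(x)) ∪ {x}`. -/
def Ztop : TopologicalSpace M4 :=
  TopologicalSpace.generateFrom {s : Set M4 | ∃ x : M4, ∃ r : ℝ, 0 < r ∧ s = zeemanBall x r}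

lemma continuous_Q : Continuous Q := by
  unfold Q
  fun_prop

lemma mem_zeemanBall_self (x : M4) (r : ℝ) : x ∈ zeemanBall x r := Or.inr rfl

lemma zeemanBall_mono (x : M4) {r s : ℝ} (h : r ≤ s) : zeemanBall x r ⊆ zeemanBall x s :=
  Set.union_subset_union_left _ (Set.sdiff_subset_sdiff_left (Metric.ball_subset_ball h))

/-- Away from its center, a basic Zeeman neighbourhood is a Euclidean neighbourhood. -/
lemma zeemanBall_mem_nhds_of_ne {x y : M4} {r : ℝ} (hx : x ∈ zeemanBall y r) (hne : x ≠ y) :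
    zeemanBall y r ∈ nhds x := by
  obtain ⟨hball, hcone⟩ := hx.resolve_right hne
  have hQ : Q (x - y) ≠ 0 := fun h => hcone ⟨hne, h⟩
  have hcont : Continuous fun z : M4 => Q (z - y) :=
    continuous_Q.comp (continuous_id.sub continuous_const)
  filter_upwards [Metric.isOpen_ball.mem_nhds hball,
    (isOpen_ne_fun hcont continuous_const).mem_nhds hQ] with z hz hzQ
  exact Or.inl ⟨hz, fun h => hzQ h.2⟩

lemma exists_zeemanBall_subset {x y : M4} {r : ℝ} (hr : 0 < r) (hx : x ∈ zeemanBall y r) :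
    ∃ ε > 0, zeemanBall x ε ⊆ zeemanBall y r := by
  by_cases hne : x = y
  · exact ⟨r, hr, hne ▸ subset_rfl⟩
  · obtain ⟨ε, hε, hsub⟩ := Metric.mem_nhds_iff.1 (zeemanBall_mem_nhds_of_ne hx hne)
    exact ⟨ε, hε, Set.union_subset (Set.sdiff_subset.trans hsub) (Set.singleton_subset_iff.2 hx)⟩

/-- The sets `zeemanBall x (1 / (n + 1))` generate the neighbourhood filter of `x` in `Z`. -/
lemma nhds_Ztop (x : M4) :
    @nhds M4 Ztop x = ⨅ n : ℕ, Filter.principal (zeemanBall x (1 / ((n : ℝ) + 1))) := by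
  rw [Ztop, TopologicalSpace.nhds_generateFrom]
  apply le_antisymm
  · exact le_iInf fun n =>
      iInf₂_le _ ⟨mem_zeemanBall_self x _, x, _, Nat.one_div_pos_of_nat, rfl⟩
  · refine le_iInf₂ ?_
    rintro _ ⟨hx, y, r, hr, rfl⟩
    obtain ⟨ε, hε, hsub⟩ := exists_zeemanBall_subset hr hx
    obtain ⟨n, hn⟩ := exists_nat_one_div_lt hε
    exact iInf_le_of_le n (Filter.principal_mono.2 ((zeemanBall_mono x hn.le).trans hsub))

/-- Minkowski space with the Zeeman topology `Z` is first countable: the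
neighbourhood filter of every point is countably generated, i.e. every point
has a countable neighbourhood basis. -/
theorem zeeman_firstCountable :
    @FirstCountableTopology M4 Ztop := by
  refine @FirstCountableTopology.mk M4 Ztop fun x => ?_
  rw [nhds_Ztop]
  infer_instance
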